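/- Let Ω ⊆ ℂ be a lower computable open set, let K ⊆ Ω be a computable compact set, and let f : Ω → f(Ω) be a homeomorphism onto its image which is computable on K. Then the inverse f⁻¹ : f(K) → K is computable on f(K). -/

import Mathlib

open Complex Metric Set Filter Polynomial

noncomputable section

/-- `x` is a computable real number. -/
def ComputableReal (x : ℝ) : Prop :=
  ∃ g : ℕ → ℚ, Computable g ∧ ∀ n : ℕ, |(g n : ℝ) - x| < (1 / 2) ^ n

/-- `z` is a computable complex number. -/
def ComputableComplex (z : ℂ) : Prop :=
  ComputableReal z.re ∧ ComputableReal z.im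

/-- The point of `ℂ` with rational coordinates `q`. -/
def ratPoint (q : ℚ × ℚ) : ℂ := ⟨(q.1 : ℝ), (q.2 : ℝ)⟩

/-- The rational ball coded by the triple `c` (center coordinates, radius). -/
def ratBall (c : ℚ × ℚ × ℚ) : Set ℂ := Metric.ball (ratPoint (c.1, c.2.1)) (c.2.2 : ℝ)

/-- A computable enumeration of (codes of) rational balls. -/
def ballEnum (n : ℕ) : ℚ × ℚ × ℚ := Denumerable.ofNat (ℚ × ℚ × ℚ) n

/-- `U` is a lower computable (recursively enumerable) open subset of `ℂ`:
it is a union of a computable sequence of rational balls. -/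
def LowerComputableOpen (U : Set ℂ) : Prop :=
  ∃ g : ℕ → ℚ × ℚ × ℚ, Computable g ∧ U = ⋃ n, ratBall (g n)

/-- `K` is a computable (compact) subset of `ℂ`: there is a computable assignment of a
finite list of rational points to each `n`, within Hausdorff distance `2⁻ⁿ` of `K`. -/
def ComputableCompactSet (K : Set ℂ) : Prop :=
  ∃ C : ℕ → List (ℚ × ℚ), Computable C ∧
    ∀ n : ℕ, (C n = [] ↔ K = ∅) ∧
      Metric.hausdorffDist (ratPoint '' {q | q ∈ C n}) K < (1 / 2) ^ n

/-- `x` is a uniformly computable sequence of complex numbers. -/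
def UniformlyComputableSeq (x : ℕ → ℂ) : Prop :=
  ∃ h : ℕ × ℕ → ℚ × ℚ, Computable h ∧
    ∀ n m : ℕ, dist (ratPoint (h (n, m))) (x n) ≤ (1 / 2) ^ m

/-- A compact set `K` is lower computable if some uniformly computable sequence of
points of `K` is dense in `K`. -/
def LowerComputableCompact (K : Set ℂ) : Prop :=
  ∃ x : ℕ → ℂ, (∀ n, x n ∈ K) ∧ UniformlyComputableSeq x ∧ K ⊆ closure (Set.range x)

/-- `f` is computable on `S`: preimages of rational balls are, relative to `S`,
uniformly lower computable open sets. -/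
def ComputableOn (f : ℂ → ℂ) (S : Set ℂ) : Prop :=
  ∃ e : ℕ × ℕ → ℚ × ℚ × ℚ, Computable e ∧
    ∀ n : ℕ, f ⁻¹' ratBall (ballEnum n) ∩ S = (⋃ k, ratBall (e (n, k))) ∩ S

/-- The filled Julia set of `f`: points with bounded forward orbit. -/
def filledJulia (f : ℂ → ℂ) : Set ℂ :=
  {z : ℂ | Bornology.IsBounded (Set.range fun n : ℕ => f^[n] z)}

/-- The Julia set of `f`: the boundary of the filled Julia set. -/
def juliaSet (f : ℂ → ℂ) : Set ℂ := frontier (filledJulia f)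

/-- The external ray of angle `t` (traced by `r ↦ φ (r e^{2πit})`, `r > 1`) lands at `w`. -/
def Lands (φ : ℂ → ℂ) (t : ℝ) (w : ℂ) : Prop :=
  Filter.Tendsto (fun r : ℝ => φ ((r : ℂ) * Complex.exp (2 * Real.pi * Complex.I * (t : ℂ))))
    (nhdsWithin 1 (Set.Ioi 1)) (nhds w)

/-! ### Computability of rational arithmetic -/

/-- The natural code of a rational underlying the enumeration of `ℚ`. -/
def ratCode (q : ℚ) : ℕ := @Encodable.encode ℚ Rat.instEncodable q

lemma ratCode_eq (q : ℚ) : ratCode q = Nat.pair (Equiv.intEquivNat q.num) q.den := rfl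

/-- Admissible codes. -/
def codeOK (x : ℕ) : Prop :=
  0 < x.unpair.2 ∧ ∀ d < x + 1, (((x.unpair.1 + 1) / 2) % d = 0 ∧ x.unpair.2 % d = 0 → d = 1)

lemma intEquivNat_half (n : ℤ) : (Equiv.intEquivNat n + 1) / 2 = n.natAbs := by
  cases n with
  | ofNat n =>
    have : Equiv.intEquivNat (Int.ofNat n) = 2 * n := rfl
    rw [this]; simp; omega
  | negSucc n =>
    have : Equiv.intEquivNat (Int.negSucc n) = 2 * n + 1 := rfl
    rw [this]; simp; omega

lemma codeOK_pair (n : ℤ) (d : ℕ) :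
    codeOK (Nat.pair (Equiv.intEquivNat n) d) ↔ 0 < d ∧ n.natAbs.Coprime d := by
  unfold codeOK
  simp only [Nat.unpair_pair, intEquivNat_half]
  refine and_congr_right fun hd => ⟨fun h => ?_, fun h e _ he => ?_⟩
  · have h1 : n.natAbs.gcd d ≤ d := Nat.gcd_le_right _ hd
    have h2 : d ≤ Nat.pair (Equiv.intEquivNat n) d := Nat.right_le_pair _ _
    exact h _ (by omega) ⟨Nat.mod_eq_zero_of_dvd (Nat.gcd_dvd_left _ _),
      Nat.mod_eq_zero_of_dvd (Nat.gcd_dvd_right _ _)⟩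
  · exact Nat.eq_one_of_dvd_coprimes h (Nat.dvd_of_mod_eq_zero he.1) (Nat.dvd_of_mod_eq_zero he.2)

lemma codeOK_iff (x : ℕ) : codeOK x ↔ x ∈ Set.range ratCode := by
  constructor
  · intro h
    obtain ⟨n, hn⟩ := Equiv.intEquivNat.surjective x.unpair.1
    have hx : x = Nat.pair (Equiv.intEquivNat n) x.unpair.2 := by rw [hn, Nat.pair_unpair]
    rw [hx, codeOK_pair] at h
    refine ⟨⟨n, x.unpair.2, h.1.ne', h.2⟩, ?_⟩
    rw [ratCode_eq]; exact hx.symm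
  · rintro ⟨q, rfl⟩
    rw [ratCode_eq, codeOK_pair]
    exact ⟨q.den_pos, q.reduced⟩

instance : DecidablePred codeOK := Classical.decPred _

lemma codeOK_comp : ComputablePred codeOK := by
  have hR : PrimrecRel fun (d x : ℕ) =>
      (((x.unpair.1 + 1) / 2) % d = 0 ∧ x.unpair.2 % d = 0 → d = 1) := by
    have h1 : Primrec fun p : ℕ × ℕ => ((p.2.unpair.1 + 1) / 2) % p.1 :=
      Primrec.nat_mod.comp (Primrec.nat_div.comp (Primrec.succ.comp
        (Primrec.fst.comp (Primrec.unpair.comp Primrec.snd))) (Primrec.const 2)) Primrec.fst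
    have h2 : Primrec fun p : ℕ × ℕ => p.2.unpair.2 % p.1 :=
      Primrec.nat_mod.comp (Primrec.snd.comp (Primrec.unpair.comp Primrec.snd)) Primrec.fst
    have := (((Primrec.eq.comp h1 (Primrec.const 0)).and
      (Primrec.eq.comp h2 (Primrec.const 0))).not).or
        (Primrec.eq.comp (Primrec.fst (α := ℕ) (β := ℕ)) (Primrec.const 1))
    exact this.of_eq fun p => by tauto
  have h3 : PrimrecPred fun x : ℕ => ∀ d < x + 1,
      (((x.unpair.1 + 1) / 2) % d = 0 ∧ x.unpair.2 % d = 0 → d = 1) :=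
    hR.forall_lt.comp Primrec.succ Primrec.id
  have h4 : PrimrecPred fun x : ℕ => 0 < x.unpair.2 :=
    Primrec.nat_lt.comp (Primrec.const 0) (Primrec.snd.comp Primrec.unpair)
  exact (h4.and h3).computablePred

/-- The `n`-th admissible code. -/
def nthCode (n : ℕ) : ℕ := ratCode (Denumerable.ofNat ℚ n)

lemma nthCode_eq' : ∃ (_ : DecidablePred (· ∈ Set.range ratCode)) (_ : Infinite (Set.range ratCode)),
    ∀ n, nthCode n = (Nat.Subtype.ofNat (Set.range ratCode) n : ℕ) := by
  let i1 : DecidablePred (· ∈ Set.range ratCode) :=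
    @Encodable.decidableRangeEncode ℚ Rat.instEncodable
  let i2 : Infinite (Set.range ratCode) :=
    Infinite.of_injective _ (Equiv.ofInjective _ (@Encodable.encode_injective ℚ
      Rat.instEncodable)).injective
  refine ⟨i1, i2, fun n => ?_⟩
  have h : Denumerable.ofNat ℚ n = (Encodable.equivRangeEncode ℚ).symm
      (Nat.Subtype.ofNat (Set.range ratCode) n) := by
    let i3 := Nat.Subtype.denumerable (Set.range ratCode)
    exact @Denumerable.ofEquiv_ofNat (Set.range ratCode) ℚ i3 (Encodable.equivRangeEncode ℚ) n
  unfold nthCode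
  rw [h]
  have := (Encodable.equivRangeEncode ℚ).apply_symm_apply
      (Nat.Subtype.ofNat (Set.range ratCode) n)
  exact congrArg Subtype.val this

lemma exists_next (x : ℕ) : ∃ m, codeOK (x + m + 1) := by
  obtain ⟨_, hinf, _⟩ := nthCode_eq'
  obtain ⟨y, hy, hxy⟩ := (Set.infinite_coe_iff.1 hinf).exists_gt x
  exact ⟨y - x - 1, by rw [show x + (y - x - 1) + 1 = y by omega]; exact (codeOK_iff _).2 hy⟩

lemma nthCode_succ (n : ℕ) : nthCode (n + 1) = nthCode n + Nat.find (exists_next (nthCode n)) + 1 := by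
  obtain ⟨hd, hinf, h⟩ := nthCode_eq'
  rw [h (n + 1)]
  have h1 : (Nat.Subtype.ofNat (Set.range ratCode) (n + 1) : ℕ) =
    (Nat.Subtype.succ (Nat.Subtype.ofNat (Set.range ratCode) n) : ℕ) := rfl
  have h2 : ∃ m, nthCode n + m + 1 ∈ Set.range ratCode := by
    simpa only [codeOK_iff] using exists_next (nthCode n)
  have h3 : (Nat.Subtype.succ (Nat.Subtype.ofNat (Set.range ratCode) n) : ℕ) =
      nthCode n + Nat.find h2 + 1 := by
    unfold Nat.Subtype.succ
    simp only [h n]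
  rw [h1, h3]
  congr 2
  apply Nat.find_congr'
  intro m
  exact (codeOK_iff _).symm

lemma nthCode_comp : Computable nthCode := by
  have h1 : Computable fun x : ℕ => Nat.find (exists_next x) := by
    refine Computable.find (P := fun x m => codeOK (x + m + 1)) ?_ exists_next
    refine Computable.computablePred ?_
    exact codeOK_comp.decide.comp (Computable.succ.comp
      (Primrec.nat_add.to_comp.comp Computable.fst Computable.snd))
  have h2 : Computable fun x : ℕ => x + Nat.find (exists_next x) + 1 :=
    Computable.succ.comp (Primrec.nat_add.to_comp.comp Computable.id h1)
  have h3 := Computable.nat_rec (f := fun n : ℕ => n) (g := fun _ => nthCode 0)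
    (h := fun _ p => p.2 + Nat.find (exists_next p.2) + 1) Computable.id (Computable.const _)
    ((h2.comp (Computable.snd.comp Computable.snd)).to₂)
  refine h3.of_eq fun n => ?_
  induction n with
  | zero => rfl
  | succ n ih => simp only at ih ⊢; rw [ih, nthCode_succ]

lemma ratCode_comp : Computable ratCode := by
  have : Computable fun q : ℚ => nthCode (@Encodable.encode ℚ Primcodable.toEncodable q) :=
    nthCode_comp.comp Computable.encode
  refine this.of_eq fun q => ?_
  unfold nthCode
  congr 1
  exact Denumerable.ofNat_encode q

/-- Positive part of the numerator. -/
def ratP (q : ℚ) : ℕ := bif (ratCode q).unpair.1 % 2 == 0 then (ratCode q).unpair.1 / 2 else 0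
/-- Negative part of the numerator. -/
def ratM (q : ℚ) : ℕ :=
  bif (ratCode q).unpair.1 % 2 == 0 then 0 else ((ratCode q).unpair.1 + 1) / 2

lemma rat_num (q : ℚ) : q.num = (ratP q : ℤ) - ratM q := by
  unfold ratP ratM
  rw [ratCode_eq, Nat.unpair_pair]
  simp only
  generalize q.num = n
  cases n with
  | ofNat n =>
    have : Equiv.intEquivNat (Int.ofNat n) = 2 * n := rfl
    rw [this]; simp
  | negSucc n =>
    have : Equiv.intEquivNat (Int.negSucc n) = 2 * n + 1 := rfl
    rw [this]
    have h : (2 * n + 1) % 2 = 1 := by omega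
    rw [h]; simp; omega

lemma rat_eq (q : ℚ) : q = ((ratP q : ℚ) - ratM q) / q.den := by
  conv_lhs => rw [← Rat.num_div_den q, rat_num q]
  push_cast; rfl

lemma den_comp : Computable (fun q : ℚ => q.den) :=
  (Computable.snd.comp (Computable.unpair.comp ratCode_comp)).of_eq fun q => by
    rw [ratCode_eq, Nat.unpair_pair]

lemma ratP_comp : Computable ratP := by
  have h : Primrec fun x : ℕ => bif x.unpair.1 % 2 == 0 then x.unpair.1 / 2 else 0 := by
    have h1 : Primrec fun x : ℕ => x.unpair.1 := Primrec.fst.comp Primrec.unpair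
    exact Primrec.cond (Primrec.beq.comp (Primrec.nat_mod.comp h1 (Primrec.const 2))
      (Primrec.const 0)) (Primrec.nat_div.comp h1 (Primrec.const 2)) (Primrec.const 0)
  exact h.to_comp.comp ratCode_comp

lemma ratM_comp : Computable ratM := by
  have h : Primrec fun x : ℕ => bif x.unpair.1 % 2 == 0 then 0 else (x.unpair.1 + 1) / 2 := by
    have h1 : Primrec fun x : ℕ => x.unpair.1 := Primrec.fst.comp Primrec.unpair
    exact Primrec.cond (Primrec.beq.comp (Primrec.nat_mod.comp h1 (Primrec.const 2))
      (Primrec.const 0)) (Primrec.const 0)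
      (Primrec.nat_div.comp (Primrec.succ.comp h1) (Primrec.const 2))
  exact h.to_comp.comp ratCode_comp

section ops
variable {α : Type*} [Primcodable α]

lemma comp_add {f g : α → ℕ} (hf : Computable f) (hg : Computable g) :
    Computable fun a => f a + g a := Primrec.nat_add.to_comp.comp hf hg
lemma comp_mul {f g : α → ℕ} (hf : Computable f) (hg : Computable g) :
    Computable fun a => f a * g a := Primrec.nat_mul.to_comp.comp hf hg
lemma comp_le {f g : α → ℕ} (hf : Computable f) (hg : Computable g) :
    ComputablePred fun a => f a ≤ g a :=
  Computable.computablePred (Primrec.nat_le.decide.to_comp.comp hf hg)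
lemma comp_eq {f g : α → ℕ} (hf : Computable f) (hg : Computable g) :
    ComputablePred fun a => f a = g a :=
  Computable.computablePred (Primrec.eq.decide.to_comp.comp hf hg)

lemma rat_le_iff (p q : ℚ) : p ≤ q ↔ ratP p * q.den + ratM q * p.den ≤
    ratP q * p.den + ratM p * q.den := by
  have hp : (0 : ℚ) < p.den := by exact_mod_cast p.den_pos
  have hq : (0 : ℚ) < q.den := by exact_mod_cast q.den_pos
  conv_lhs => rw [rat_eq p, rat_eq q, div_le_div_iff₀ hp hq]
  rw [← Nat.cast_le (α := ℚ)]
  push_cast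
  constructor <;> intro h <;> linarith

lemma qle {f g : α → ℚ} (hf : Computable f) (hg : Computable g) :
    ComputablePred fun a => f a ≤ g a := by
  refine (comp_le (comp_add (comp_mul (ratP_comp.comp hf) (den_comp.comp hg))
    (comp_mul (ratM_comp.comp hg) (den_comp.comp hf)))
    (comp_add (comp_mul (ratP_comp.comp hg) (den_comp.comp hf))
    (comp_mul (ratM_comp.comp hf) (den_comp.comp hg)))).of_eq fun a => ?_
  exact (rat_le_iff _ _).symm

lemma qlt {f g : α → ℚ} (hf : Computable f) (hg : Computable g) :
    ComputablePred fun a => f a < g a :=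
  (qle hg hf).not.of_eq fun _ => not_le

lemma rat_add_iff (p q r : ℚ) : p + q = r ↔
    ratP p * q.den * r.den + ratP q * p.den * r.den + ratM r * p.den * q.den =
    ratM p * q.den * r.den + ratM q * p.den * r.den + ratP r * p.den * q.den := by
  have hp : (p.den : ℚ) ≠ 0 := by exact_mod_cast p.den_ne_zero
  have hq : (q.den : ℚ) ≠ 0 := by exact_mod_cast q.den_ne_zero
  have hr : (r.den : ℚ) ≠ 0 := by exact_mod_cast r.den_ne_zero
  conv_lhs => rw [rat_eq p, rat_eq q, rat_eq r, div_add_div _ _ hp hq,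
    div_eq_div_iff (mul_ne_zero hp hq) hr]
  rw [← Nat.cast_inj (R := ℚ)]
  push_cast
  constructor <;> intro h <;> linarith

lemma rat_mul_iff (p q r : ℚ) : p * q = r ↔
    ratP p * ratP q * r.den + ratM p * ratM q * r.den + ratM r * p.den * q.den =
    ratP p * ratM q * r.den + ratM p * ratP q * r.den + ratP r * p.den * q.den := by
  have hp : (p.den : ℚ) ≠ 0 := by exact_mod_cast p.den_ne_zero
  have hq : (q.den : ℚ) ≠ 0 := by exact_mod_cast q.den_ne_zero
  have hr : (r.den : ℚ) ≠ 0 := by exact_mod_cast r.den_ne_zero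
  conv_lhs => rw [rat_eq p, rat_eq q, rat_eq r, div_mul_div_comm,
    div_eq_div_iff (mul_ne_zero hp hq) hr]
  rw [← Nat.cast_inj (R := ℚ)]
  push_cast
  constructor <;> intro h <;> linarith

lemma qadd_rel {f g h : α → ℚ} (hf : Computable f) (hg : Computable g) (hh : Computable h) :
    ComputablePred fun a => f a + g a = h a := by
  have F := den_comp.comp hf
  have G := den_comp.comp hg
  have H := den_comp.comp hh
  refine (comp_eq
    (comp_add (comp_add (comp_mul (comp_mul (ratP_comp.comp hf) G) H)
      (comp_mul (comp_mul (ratP_comp.comp hg) F) H)) (comp_mul (comp_mul (ratM_comp.comp hh) F) G))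
    (comp_add (comp_add (comp_mul (comp_mul (ratM_comp.comp hf) G) H)
      (comp_mul (comp_mul (ratM_comp.comp hg) F) H)) (comp_mul (comp_mul (ratP_comp.comp hh) F) G))
      ).of_eq fun a => ?_
  exact (rat_add_iff _ _ _).symm

lemma qmul_rel {f g h : α → ℚ} (hf : Computable f) (hg : Computable g) (hh : Computable h) :
    ComputablePred fun a => f a * g a = h a := by
  have F := den_comp.comp hf
  have G := den_comp.comp hg
  have H := den_comp.comp hh
  have f1 := ratP_comp.comp hf
  have f2 := ratM_comp.comp hf
  have g1 := ratP_comp.comp hg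
  have g2 := ratM_comp.comp hg
  refine (comp_eq
    (comp_add (comp_add (comp_mul (comp_mul f1 g1) H)
      (comp_mul (comp_mul f2 g2) H)) (comp_mul (comp_mul (ratM_comp.comp hh) F) G))
    (comp_add (comp_add (comp_mul (comp_mul f1 g2) H)
      (comp_mul (comp_mul f2 g1) H)) (comp_mul (comp_mul (ratP_comp.comp hh) F) G))
      ).of_eq fun a => ?_
  exact (rat_mul_iff _ _ _).symm

lemma ccomp {β : Type*} [Primcodable β] {p : β → Prop} (hp : ComputablePred p) {f : α → β}
    (hf : Computable f) : ComputablePred fun a => p (f a) := by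
  classical
  exact Computable.computablePred (hp.decide.comp hf)

lemma comp_of_graph {f : α → ℚ} (h : ComputablePred fun p : α × ℚ => f p.1 = p.2) :
    Computable f := by
  classical
  have hex : ∀ a, ∃ n, f a = Denumerable.ofNat ℚ n := fun a =>
    ⟨@Encodable.encode ℚ Primcodable.toEncodable (f a), (Denumerable.ofNat_encode _).symm⟩
  have h1 : Computable fun a => Nat.find (hex a) := by
    refine Computable.find (P := fun a n => f a = Denumerable.ofNat ℚ n) ?_ hex
    exact ccomp h (f := fun p : α × ℕ => (p.1, Denumerable.ofNat ℚ p.2))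
      (Computable.pair Computable.fst ((Computable.ofNat ℚ).comp Computable.snd))
  exact ((Computable.ofNat ℚ).comp h1).of_eq fun a => (Nat.find_spec (hex a)).symm

lemma qadd {f g : α → ℚ} (hf : Computable f) (hg : Computable g) :
    Computable fun a => f a + g a :=
  comp_of_graph (qadd_rel (hf.comp Computable.fst) (hg.comp Computable.fst) Computable.snd)

lemma qmul {f g : α → ℚ} (hf : Computable f) (hg : Computable g) :
    Computable fun a => f a * g a :=
  comp_of_graph (qmul_rel (hf.comp Computable.fst) (hg.comp Computable.fst) Computable.snd)

lemma qsub {f g : α → ℚ} (hf : Computable f) (hg : Computable g) :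
    Computable fun a => f a - g a :=
  comp_of_graph ((qadd_rel Computable.snd (hg.comp Computable.fst)
    (hf.comp Computable.fst)).of_eq fun p => by
      constructor <;> intro h <;> linarith)

lemma qpow {f : α → ℕ} (hf : Computable f) :
    Computable fun a => ((1 / 2 : ℚ)) ^ f a := by
  have := Computable.nat_rec (f := f) (g := fun _ => (1 : ℚ))
    (h := fun _ p => p.2 * (1 / 2)) hf (Computable.const _)
    (qmul (Computable.snd.comp Computable.snd) (Computable.const _)).to₂
  refine this.of_eq fun a => ?_
  generalize f a = n
  induction n with
  | zero => simp
  | succ n ih => simp only at ih ⊢; rw [ih, pow_succ]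

lemma cand {p q : α → Prop} (hp : ComputablePred p) (hq : ComputablePred q) :
    ComputablePred fun a => p a ∧ q a := by
  classical
  exact Computable.computablePred
    ((Primrec.and.to_comp.comp hp.decide hq.decide).of_eq fun a => by simp)

lemma cor {p q : α → Prop} (hp : ComputablePred p) (hq : ComputablePred q) :
    ComputablePred fun a => p a ∨ q a := by
  classical
  exact Computable.computablePred
    ((Primrec.or.to_comp.comp hp.decide hq.decide).of_eq fun a => by simp)

lemma cforall {p : α → ℕ → Prop} (hp : ComputablePred fun x : α × ℕ => p x.1 x.2) {f : α → ℕ}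
    (hf : Computable f) : ComputablePred fun a => ∀ i < f a, p a i := by
  classical
  have := Computable.nat_rec (f := f) (g := fun _ => true)
    (h := fun a x => x.2 && decide (p a x.1)) hf (Computable.const _)
    (Primrec.and.to_comp.comp (Computable.snd.comp Computable.snd)
      (hp.decide.comp (Computable.pair Computable.fst
        (Computable.fst.comp Computable.snd)))).to₂
  refine Computable.computablePred (this.of_eq fun a => ?_)
  generalize f a = n
  induction n with
  | zero => simp
  | succ n ih =>
    simp only at ih ⊢
    rw [ih, ← Bool.decide_and]
    congr 1
    rw [Nat.forall_lt_succ_right]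

lemma cexists {p : α → ℕ → Prop} (hp : ComputablePred fun x : α × ℕ => p x.1 x.2) {f : α → ℕ}
    (hf : Computable f) : ComputablePred fun a => ∃ i < f a, p a i :=
  (cforall (p := fun a i => ¬ p a i) hp.not hf).not.of_eq fun a => by push Not; rfl

end ops

/-! ### Decidable geometry of rational balls -/

/-- Squared distance of two rational points. -/
def dsq (p q : ℚ × ℚ) : ℚ := (p.1 - q.1) * (p.1 - q.1) + (p.2 - q.2) * (p.2 - q.2)

/-- The ball of radius `ε` about `p` is well inside the ball coded by `c`. -/
def inside (p : ℚ × ℚ) (ε : ℚ) (c : ℚ × ℚ × ℚ) : Prop :=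
  ε < c.2.2 ∧ dsq p (c.1, c.2.1) < (c.2.2 - ε) * (c.2.2 - ε)

/-- The balls coded by `c` and `v` are apart. -/
def apart (c v : ℚ × ℚ × ℚ) : Prop :=
  (c.2.2 + v.2.2) * (c.2.2 + v.2.2) ≤ dsq (c.1, c.2.1) (v.1, v.2.1)

lemma dsq_eq (p q : ℚ × ℚ) : (dsq p q : ℝ) = dist (ratPoint p) (ratPoint q) ^ 2 := by
  rw [Complex.dist_eq, Complex.sq_norm, Complex.normSq_apply]
  simp [dsq, ratPoint]

lemma inside_iff (p : ℚ × ℚ) (ε : ℚ) (c : ℚ × ℚ × ℚ) :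
    inside p ε c ↔ dist (ratPoint p) (ratPoint (c.1, c.2.1)) + (ε : ℝ) < (c.2.2 : ℝ) := by
  unfold inside
  rw [← Rat.cast_lt (K := ℝ), ← Rat.cast_lt (K := ℝ), dsq_eq]
  push_cast
  have h0 : 0 ≤ dist (ratPoint p) (ratPoint (c.1, c.2.1)) := dist_nonneg
  constructor
  · rintro ⟨h1, h2⟩
    rw [← sq] at h2
    have := abs_lt_of_sq_lt_sq h2 (by linarith)
    rw [abs_of_nonneg h0] at this
    linarith
  · intro h
    refine ⟨by linarith, ?_⟩
    nlinarith

lemma apart_of_le {c v : ℚ × ℚ × ℚ} (h0 : 0 ≤ c.2.2 + v.2.2)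
    (h : (c.2.2 : ℝ) + v.2.2 ≤ dist (ratPoint (c.1, c.2.1)) (ratPoint (v.1, v.2.1))) :
    apart c v := by
  unfold apart
  rw [← Rat.cast_le (K := ℝ), dsq_eq]
  have h0' : (0 : ℝ) ≤ c.2.2 + v.2.2 := by exact_mod_cast h0
  push_cast
  nlinarith

lemma le_of_apart {c v : ℚ × ℚ × ℚ} (h : apart c v) :
    (c.2.2 : ℝ) + v.2.2 ≤ dist (ratPoint (c.1, c.2.1)) (ratPoint (v.1, v.2.1)) := by
  unfold apart at h
  rw [← Rat.cast_le (K := ℝ), dsq_eq] at h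
  push_cast at h
  exact le_of_abs_le (abs_le_of_sq_le_sq (by rw [sq]; exact h) dist_nonneg)

lemma apart_disjoint {c v : ℚ × ℚ × ℚ} (h : apart c v) {z : ℂ} (h1 : z ∈ ratBall c)
    (h2 : z ∈ ratBall v) : False := by
  have := le_of_apart h
  simp only [ratBall, Metric.mem_ball] at h1 h2
  have h3 := dist_triangle_left (ratPoint (c.1, c.2.1)) (ratPoint (v.1, v.2.1)) z
  linarith

section geom
variable {α : Type*} [Primcodable α]

lemma dsq_comp {f g : α → ℚ × ℚ} (hf : Computable f) (hg : Computable g) :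
    Computable fun a => dsq (f a) (g a) := by
  have h1 := qsub (Computable.fst.comp hf) (Computable.fst.comp hg)
  have h2 := qsub (Computable.snd.comp hf) (Computable.snd.comp hg)
  exact qadd (qmul h1 h1) (qmul h2 h2)

lemma center_comp {f : α → ℚ × ℚ × ℚ} (hf : Computable f) :
    Computable fun a => ((f a).1, (f a).2.1) :=
  Computable.pair (Computable.fst.comp hf) (Computable.fst.comp (Computable.snd.comp hf))

lemma radius_comp {f : α → ℚ × ℚ × ℚ} (hf : Computable f) :
    Computable fun a => (f a).2.2 := Computable.snd.comp (Computable.snd.comp hf)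

lemma inside_comp {f : α → ℚ × ℚ} {g : α → ℚ} {h : α → ℚ × ℚ × ℚ} (hf : Computable f)
    (hg : Computable g) (hh : Computable h) :
    ComputablePred fun a => inside (f a) (g a) (h a) := by
  have h1 := qsub (radius_comp hh) hg
  exact cand (qlt hg (radius_comp hh)) (qlt (dsq_comp hf (center_comp hh)) (qmul h1 h1))

lemma apart_comp {f g : α → ℚ × ℚ × ℚ} (hf : Computable f) (hg : Computable g) :
    ComputablePred fun a => apart (f a) (g a) := by
  have h1 := qadd (radius_comp hf) (radius_comp hg)
  exact qle (qmul h1 h1) (dsq_comp (center_comp hf) (center_comp hg))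

end geom

/-- Local test at the point `p`, at stage `s`. -/
def locTest (e : ℕ × ℕ → ℚ × ℚ × ℚ) (n : ℕ) (v : ℚ × ℚ × ℚ) (s : ℕ) (p : ℚ × ℚ) : Prop :=
  inside p ((1 / 2) ^ s) (ballEnum n) ∨
    ∃ j < s, apart (ballEnum j.unpair.1) v ∧ inside p ((1 / 2) ^ s) (e j.unpair)

/-- Full test at stage `s`. -/
def stageTest (e : ℕ × ℕ → ℚ × ℚ × ℚ) (C : ℕ → List (ℚ × ℚ)) (n : ℕ) (v : ℚ × ℚ × ℚ)
    (s : ℕ) : Prop :=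
  ∀ i < (C s).length, locTest e n v s ((C s)[i]?.getD (0, 0))

lemma stageTest_iff (e : ℕ × ℕ → ℚ × ℚ × ℚ) (C : ℕ → List (ℚ × ℚ)) (n : ℕ) (v : ℚ × ℚ × ℚ)
    (s : ℕ) : stageTest e C n v s ↔ ∀ p ∈ C s, locTest e n v s p := by
  unfold stageTest
  constructor
  · intro h p hp
    obtain ⟨i, hi, rfl⟩ := List.getElem_of_mem hp
    have := h i hi
    rwa [List.getElem?_eq_getElem hi] at this
  · intro h i hi
    rw [List.getElem?_eq_getElem hi]
    exact h _ (List.getElem_mem hi)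

lemma ballEnum_surj (v : ℚ × ℚ × ℚ) : ∃ m, ballEnum m = v :=
  ⟨@Encodable.encode _ Denumerable.toEncodable v, Denumerable.ofNat_encode v⟩

lemma ballEnum_comp : Computable ballEnum := Computable.ofNat (ℚ × ℚ × ℚ)

lemma locTest_comp {e : ℕ × ℕ → ℚ × ℚ × ℚ} (he : Computable e) {α : Type*} [Primcodable α]
    {n s : α → ℕ} {v : α → ℚ × ℚ × ℚ} {p : α → ℚ × ℚ} (hn : Computable n) (hs : Computable s)
    (hv : Computable v) (hp : Computable p) :
    ComputablePred fun a => locTest e (n a) (v a) (s a) (p a) := by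
  refine cor (inside_comp hp (qpow hs) (ballEnum_comp.comp hn)) ?_
  have hj : Computable fun x : α × ℕ => x.2.unpair := Computable.unpair.comp Computable.snd
  exact cexists (p := fun a j => apart (ballEnum j.unpair.1) (v a) ∧
    inside (p a) ((1 / 2) ^ (s a)) (e j.unpair))
    (cand (apart_comp (ballEnum_comp.comp (Computable.fst.comp hj)) (hv.comp Computable.fst))
      (inside_comp (hp.comp Computable.fst) (qpow (hs.comp Computable.fst)) (he.comp hj))) hs

lemma stageTest_comp {e : ℕ × ℕ → ℚ × ℚ × ℚ} (he : Computable e) {C : ℕ → List (ℚ × ℚ)}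
    (hC : Computable C) {α : Type*} [Primcodable α]
    {n s : α → ℕ} {v : α → ℚ × ℚ × ℚ} (hn : Computable n) (hs : Computable s)
    (hv : Computable v) :
    ComputablePred fun a => stageTest e C (n a) (v a) (s a) := by
  refine cforall (p := fun a i => locTest e (n a) (v a) (s a) ((C (s a))[i]?.getD (0, 0))) ?_
    (Computable.list_length.comp (hC.comp hs))
  refine locTest_comp he (hn.comp Computable.fst) (hs.comp Computable.fst)
    (hv.comp Computable.fst) ?_
  exact Computable.option_getD (Computable.list_getElem?.comp
    (hC.comp (hs.comp Computable.fst)) Computable.snd) (Computable.const _)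

open Classical in
/-- The witness enumeration for the inverse. -/
def invEnum (e : ℕ × ℕ → ℚ × ℚ × ℚ) (C : ℕ → List (ℚ × ℚ)) (x : ℕ × ℕ) : ℚ × ℚ × ℚ :=
  bif decide (stageTest e C x.1 (ballEnum x.2.unpair.1) x.2.unpair.2)
    then ballEnum x.2.unpair.1 else (0, 0, 0)

lemma invEnum_comp {e : ℕ × ℕ → ℚ × ℚ × ℚ} (he : Computable e) {C : ℕ → List (ℚ × ℚ)}
    (hC : Computable C) : Computable (invEnum e C) := by
  classical
  have hk : Computable fun x : ℕ × ℕ => x.2.unpair := Computable.unpair.comp Computable.snd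
  have hv := ballEnum_comp.comp (Computable.fst.comp hk)
  have := (stageTest_comp he hC Computable.fst (Computable.snd.comp hk) hv).decide
  refine (Computable.cond this hv (Computable.const (0, 0, 0))).of_eq fun x => ?_
  unfold invEnum
  congr

lemma mem_invEnum {e : ℕ × ℕ → ℚ × ℚ × ℚ} {C : ℕ → List (ℚ × ℚ)} {n : ℕ} {w : ℂ} :
    w ∈ (⋃ k, ratBall (invEnum e C (n, k))) ↔ ∃ v s, w ∈ ratBall v ∧ stageTest e C n v s := by
  rw [Set.mem_iUnion]
  constructor
  · rintro ⟨k, hk⟩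
    unfold invEnum at hk
    by_cases h : stageTest e C n (ballEnum k.unpair.1) k.unpair.2
    · simp only [h, decide_true, cond_true] at hk
      exact ⟨_, _, hk, h⟩
    · simp [h, ratBall] at hk
  · rintro ⟨v, s, hw, h⟩
    obtain ⟨m, hv⟩ := ballEnum_surj v
    refine ⟨Nat.pair m s, ?_⟩
    unfold invEnum
    simp only [Nat.unpair_pair, hv, h, decide_true, cond_true]
    exact hw

lemma exists_ratPoint (w : ℂ) {δ : ℝ} (hδ : 0 < δ) : ∃ q : ℚ × ℚ, dist (ratPoint q) w < δ := by
  obtain ⟨a, ha1, ha2⟩ := exists_rat_btwn (show w.re < w.re + δ / 2 by linarith)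
  obtain ⟨b, hb1, hb2⟩ := exists_rat_btwn (show w.im < w.im + δ / 2 by linarith)
  refine ⟨(a, b), ?_⟩
  rw [Complex.dist_eq]
  refine (Complex.norm_le_abs_re_add_abs_im _).trans_lt ?_
  simp only [ratPoint, Complex.sub_re, Complex.sub_im]
  rw [abs_of_nonneg (by linarith), abs_of_nonneg (by linarith)]
  linarith

/-- A rational ball of radius less than `δ` containing `w`. -/
lemma exists_ratBall (w : ℂ) {δ : ℝ} (hδ : 0 < δ) :
    ∃ v : ℚ × ℚ × ℚ, w ∈ ratBall v ∧ 0 < v.2.2 ∧ (v.2.2 : ℝ) < δ := by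
  obtain ⟨r, hr1, hr2⟩ := exists_rat_btwn hδ
  obtain ⟨q, hq⟩ := exists_ratPoint w hr1
  refine ⟨(q.1, q.2, r), ?_, by exact_mod_cast hr1, hr2⟩
  rw [ratBall, Metric.mem_ball, dist_comm]
  exact hq

lemma approx_of_compact {K : Set ℂ} (hK : IsCompact K) {L : List (ℚ × ℚ)} {ε : ℝ}
    (h0 : L = [] ↔ K = ∅) (h : Metric.hausdorffDist (ratPoint '' {q | q ∈ L}) K < ε) :
    (∀ z ∈ K, ∃ p ∈ L, dist z (ratPoint p) < ε) ∧ ∀ p ∈ L, ∃ z ∈ K, dist (ratPoint p) z < ε := by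
  by_cases hK0 : K = ∅
  · have := h0.2 hK0
    subst hK0 this
    simp
  have hL : L ≠ [] := fun h' => hK0 (h0.1 h')
  have hfin : ({q | q ∈ L} : Set (ℚ × ℚ)).Finite := L.finite_toSet
  have hne : Metric.hausdorffEDist (ratPoint '' {q | q ∈ L}) K ≠ ⊤ := by
    refine Metric.hausdorffEDist_ne_top_of_nonempty_of_bounded ?_
      (Set.nonempty_iff_ne_empty.2 hK0) (hfin.image _).isBounded hK.isBounded
    obtain ⟨p, hp⟩ := List.exists_mem_of_ne_nil L hL
    exact ⟨_, p, hp, rfl⟩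
  constructor
  · intro z hz
    obtain ⟨y, ⟨p, hp, rfl⟩, hy⟩ := Metric.exists_dist_lt_of_hausdorffDist_lt' hz h hne
    exact ⟨p, hp, by rwa [dist_comm] at hy⟩
  · intro p hp
    obtain ⟨z, hz, hy⟩ := Metric.exists_dist_lt_of_hausdorffDist_lt
      (Set.mem_image_of_mem ratPoint (show p ∈ {q | q ∈ L} from hp)) h hne
    exact ⟨z, hz, hy⟩

/-- Computable inverse: Let `Ω` be a lower computable open set, `K ⊆ Ω` a
computable compact set, and `f : Ω → f(Ω)` a homeomorphism onto its image which is computable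
on `K`. Then the inverse `f⁻¹ : f(K) → K` is computable on `f(K)`. -/
theorem computable_inverse (Ω : Set ℂ) (hΩopen : IsOpen Ω) (hΩ : LowerComputableOpen Ω)
    (K : Set ℂ) (hKΩ : K ⊆ Ω) (hK : IsCompact K) (hKc : ComputableCompactSet K)
    (f : ℂ → ℂ) (hfc : ContinuousOn f Ω) (hfinj : Set.InjOn f Ω)
    (hhomeo : ∃ g : ℂ → ℂ, ContinuousOn g (f '' Ω) ∧ ∀ w ∈ Ω, g (f w) = w)
    (hf : ComputableOn f K) :
    ∀ g : ℂ → ℂ, (∀ w ∈ K, g (f w) = w) → ComputableOn g (f '' K) := by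
  intro g hg
  obtain ⟨e, he, hfe⟩ := hf
  obtain ⟨C, hC, hCK⟩ := hKc
  have hap := fun s => approx_of_compact hK (hCK s).1 (hCK s).2
  have hfK : ContinuousOn f K := hfc.mono hKΩ
  have hinjK : Set.InjOn f K := hfinj.mono hKΩ
  refine ⟨invEnum e C, invEnum_comp he hC, fun n => ?_⟩
  ext w
  constructor
  · rintro ⟨hw, z₀, hz₀, rfl⟩
    refine ⟨?_, z₀, hz₀, rfl⟩
    rw [mem_invEnum]
    have hz₀B : z₀ ∈ ratBall (ballEnum n) := by
      have : g (f z₀) ∈ ratBall (ballEnum n) := hw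
      rwa [hg z₀ hz₀] at this
    have hBo : IsOpen (ratBall (ballEnum n)) := Metric.isOpen_ball
    -- the image of the complement is closed
    have hA : IsCompact (K \ ratBall (ballEnum n)) := hK.diff hBo
    have hfA : IsClosed (f '' (K \ ratBall (ballEnum n))) :=
      (hA.image_of_continuousOn (hfK.mono Set.sdiff_subset)).isClosed
    have hnot : f z₀ ∈ (f '' (K \ ratBall (ballEnum n)))ᶜ := by
      rintro ⟨z, ⟨hzK, hzB⟩, hz⟩
      exact hzB (hinjK hzK hz₀ hz ▸ hz₀B)
    obtain ⟨δ, hδ, hball⟩ := Metric.isOpen_iff.1 hfA.isOpen_compl _ hnot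
    obtain ⟨v, hwv, hv0, hvδ⟩ := exists_ratBall (f z₀) (show 0 < δ / 4 by linarith)
    refine ⟨v, ?_⟩
    -- increasing cover of `K`
    let W : ℕ → Set ℂ := fun s => {z | dist z (ratPoint ((ballEnum n).1, (ballEnum n).2.1)) +
        2 * (1 / 2) ^ s < ((ballEnum n).2.2 : ℝ)} ∪
      ⋃ j ∈ {j | j < s ∧ apart (ballEnum j.unpair.1) v},
        {z | dist z (ratPoint ((e j.unpair).1, (e j.unpair).2.1)) +
          2 * (1 / 2) ^ s < ((e j.unpair).2.2 : ℝ)}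
    have hWo : ∀ s, IsOpen (W s) := fun s => by
      refine IsOpen.union (isOpen_lt (by fun_prop) (by fun_prop))
        (isOpen_biUnion fun j _ => isOpen_lt (by fun_prop) (by fun_prop))
    have hpow : ∀ {s t : ℕ}, s ≤ t → ((1 / 2 : ℝ)) ^ t ≤ (1 / 2) ^ s := fun h =>
      pow_le_pow_of_le_one (by norm_num) (by norm_num) h
    have hWm : Monotone W := by
      intro s t hst z hz
      have := hpow hst
      rcases hz with hz | hz
      · left
        simp only [Set.mem_ofPred_eq] at hz ⊢
        linarith
      · right
        simp only [Set.mem_iUnion, Set.mem_ofPred_eq, exists_prop] at hz ⊢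
        obtain ⟨j, ⟨hj, hja⟩, hz⟩ := hz
        exact ⟨j, ⟨by omega, hja⟩, by linarith⟩
    have hsmall : ∀ {a b : ℝ}, a < b → ∃ s₀ : ℕ, ∀ s, s₀ ≤ s → a + 2 * (1 / 2 : ℝ) ^ s < b := by
      intro a b hab
      obtain ⟨s₀, hs₀⟩ := exists_pow_lt_of_lt_one (show 0 < (b - a) / 2 by linarith)
        (show (1 / 2 : ℝ) < 1 by norm_num)
      exact ⟨s₀, fun s hs => by have := hpow hs; linarith⟩
    have hcov : K ⊆ ⋃ s, W s := by
      intro z hz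
      rw [Set.mem_iUnion]
      by_cases hzB : z ∈ ratBall (ballEnum n)
      · obtain ⟨s, hs⟩ := hsmall (Metric.mem_ball.1 hzB)
        exact ⟨s, Or.inl (hs s le_rfl)⟩
      · have hfar : δ ≤ dist (f z) (f z₀) := by
          by_contra hlt
          exact hball (Metric.mem_ball.2 (not_le.1 hlt)) ⟨z, ⟨hz, hzB⟩, rfl⟩
        obtain ⟨c, hzc, hc0, hcδ⟩ := exists_ratBall (f z) (show 0 < δ / 4 by linarith)
        have hap : apart c v := by
          refine apart_of_le (by linarith) ?_
          have h1 := Metric.mem_ball.1 hzc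
          have h2 := Metric.mem_ball.1 hwv
          have h3 := dist_triangle4 (f z) (ratPoint (c.1, c.2.1)) (ratPoint (v.1, v.2.1)) (f z₀)
          rw [dist_comm (ratPoint (v.1, v.2.1)) (f z₀)] at h3
          linarith
        obtain ⟨m, hc⟩ := ballEnum_surj c
        have hz2 : z ∈ (⋃ k, ratBall (e (m, k))) ∩ K := by
          rw [← hfe]
          exact ⟨by rw [hc]; exact hzc, hz⟩
        obtain ⟨k, hk⟩ := Set.mem_iUnion.1 hz2.1
        obtain ⟨s, hs⟩ := hsmall (Metric.mem_ball.1 hk)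
        refine ⟨max s (Nat.pair m k + 1), Or.inr ?_⟩
        simp only [Set.mem_iUnion, Set.mem_ofPred_eq, exists_prop]
        refine ⟨Nat.pair m k, ⟨by omega, ?_⟩, ?_⟩
        · rw [Nat.unpair_pair, hc]; exact hap
        · rw [Nat.unpair_pair]; exact hs _ (le_max_left _ _)
    obtain ⟨s, hs⟩ := hK.elim_directed_cover W hWo hcov hWm.directed_le
    refine ⟨s, hwv, ?_⟩
    rw [stageTest_iff]
    intro p hp
    obtain ⟨z, hzK, hpz⟩ := (hap s).2 p hp
    have htri := fun x => dist_triangle (ratPoint p) z x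
    rcases hs hzK with hz | hz
    · left
      rw [inside_iff]
      simp only [Set.mem_ofPred_eq] at hz
      have := htri (ratPoint ((ballEnum n).1, (ballEnum n).2.1))
      push_cast
      linarith
    · right
      simp only [Set.mem_iUnion, Set.mem_ofPred_eq, exists_prop] at hz
      obtain ⟨j, ⟨hj, hja⟩, hz⟩ := hz
      refine ⟨j, hj, hja, ?_⟩
      rw [inside_iff]
      have := htri (ratPoint ((e j.unpair).1, (e j.unpair).2.1))
      push_cast
      linarith
  · rintro ⟨hw, z₀, hz₀, rfl⟩
    refine ⟨?_, z₀, hz₀, rfl⟩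
    rw [mem_invEnum] at hw
    obtain ⟨v, s, hwv, hst⟩ := hw
    rw [stageTest_iff] at hst
    change g (f z₀) ∈ ratBall (ballEnum n)
    rw [hg z₀ hz₀]
    obtain ⟨p, hp, hzp⟩ := (hap s).1 z₀ hz₀
    have htri := fun x => dist_triangle z₀ (ratPoint p) x
    rcases hst p hp with h | ⟨j, hj, hja, h⟩
    · rw [inside_iff] at h
      push_cast at h
      have := htri (ratPoint ((ballEnum n).1, (ballEnum n).2.1))
      exact Metric.mem_ball.2 (by linarith)
    · exfalso
      rw [inside_iff] at h
      push_cast at h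
      have := htri (ratPoint ((e j.unpair).1, (e j.unpair).2.1))
      have hz1 : z₀ ∈ ratBall (e j.unpair) := Metric.mem_ball.2 (by linarith)
      have hz2 : z₀ ∈ f ⁻¹' ratBall (ballEnum j.unpair.1) ∩ K := by
        rw [hfe]
        exact ⟨Set.mem_iUnion.2 ⟨j.unpair.2, hz1⟩, hz₀⟩
      exact apart_disjoint hja hz2.1 hwv
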